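/- arXiv:1705.09123 — 3 statements merged into one kernel-verified Lean document; each statement's English description precedes it below -/
import Mathlib

section
/- Let K be the attractor of an IFS of similitudes on a complete metric space with similarity dimension α, endowed with its natural fractal structure. If the Hausdorff dimension of K equals α (equivalently, dim_H(K) = dim³(K) = α), then the natural fractal structure is irreducible. -/
open scoped ENNReal

namespace IFSMoran

variable {X : Type*} [MetricSpace X]

/-- The map `f_i = f_{i1} o ... o f_{in}` associated to a word `i = i1...in`
(a list of indices). -/
def wMap {k : ℕ} (f : Fin k → X → X) : List (Fin k) → X → X
  | [] => id
  | i :: w => f i ∘ wMap f w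

/-- The piece `A_i = f_i(K)` of the natural fractal structure. -/
def piece {k : ℕ} (f : Fin k → X → X) (K : Set X) (w : List (Fin k)) : Set X :=
  wMap f w '' K

/-- The natural fractal structure (levels indexed by words) is irreducible:
no level admits a proper subcovering. -/
def Irred {k : ℕ} (f : Fin k → X → X) (K : Set X) : Prop :=
  ∀ w : List (Fin k),
    ¬ piece f K w ⊆ ⋃ v ∈ {v : List (Fin k) | v.length = w.length ∧ v ≠ w}, piece f K v

/-- `H³ₙˢ(K) = inf_{l ≥ n} ∑_{i ∈ Σˡ} diam (A_i) ^ s`. -/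
noncomputable def H3n {k : ℕ} (f : Fin k → X → X) (K : Set X) (s : ℝ) (n : ℕ) : ℝ≥0∞ :=
  ⨅ (l : ℕ) (_ : n ≤ l),
    ∑ w : Fin l → Fin k, EMetric.diam (piece f K (List.ofFn w)) ^ s

/-- `H³ˢ(K) = lim_n H³ₙˢ(K)`; the sequence is nondecreasing in `n`, so the limit
is the supremum. -/
noncomputable def H3 {k : ℕ} (f : Fin k → X → X) (K : Set X) (s : ℝ) : ℝ≥0∞ :=
  ⨆ n, H3n f K s n

/-- Fractal dimension III: `dim³(K) = inf {s ≥ 0 : H³ˢ(K) = 0}`. -/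
noncomputable def dim3 {k : ℕ} (f : Fin k → X → X) (K : Set X) : ℝ :=
  sInf {s : ℝ | 0 ≤ s ∧ H3 f K s = 0}

/-- `H⁴ₙˢ(K)`: infimum of `∑ diam (A_i) ^ s` over finite coverings of `K` by
pieces indexed by words of length `≥ n`. -/
noncomputable def H4n {k : ℕ} (f : Fin k → X → X) (K : Set X) (s : ℝ) (n : ℕ) : ℝ≥0∞ :=
  ⨅ (𝒜 : Finset (List (Fin k))) (_ : ∀ w ∈ 𝒜, n ≤ w.length)
      (_ : K ⊆ ⋃ w ∈ 𝒜, piece f K w),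
    ∑ w ∈ 𝒜, EMetric.diam (piece f K w) ^ s

/-- `H⁴ˢ(K) = lim_n H⁴ₙˢ(K)`; the sequence is nondecreasing in `n`, so the limit
is the supremum. -/
noncomputable def H4 {k : ℕ} (f : Fin k → X → X) (K : Set X) (s : ℝ) : ℝ≥0∞ :=
  ⨆ n, H4n f K s n

/-- Fractal dimension IV: `dim⁴(K) = inf {s ≥ 0 : H⁴ˢ(K) = 0}`. -/
noncomputable def dim4 {k : ℕ} (f : Fin k → X → X) (K : Set X) : ℝ :=
  sInf {s : ℝ | 0 ≤ s ∧ H4 f K s = 0}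

/-- Interior of `A` relative to `K` (as a subset of the ambient space `X`). -/
def intK (K A : Set X) : Set X := K \ closure (K \ A)

/-- The level separation property: interiors (in `K`) of two pieces indexed by
distinct words of the same length are disjoint (LSP1), and every piece has
nonempty interior in `K` (LSP2). -/
def LSP {k : ℕ} (f : Fin k → X → X) (K : Set X) : Prop :=
  (∀ v w : List (Fin k), v.length = w.length → v ≠ w →
      intK K (piece f K v) ∩ intK K (piece f K w) = ∅) ∧
  ∀ w : List (Fin k), (intK K (piece f K w)).Nonempty

/-- The natural fractal structure is a tiling: pieces indexed by distinct words
of the same length have disjoint interiors in `K`, and every piece is regularly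
closed in `K`, i.e. `cl_K (int_K (A_i)) = A_i`. -/
def IsTiling {k : ℕ} (f : Fin k → X → X) (K : Set X) : Prop :=
  (∀ v w : List (Fin k), v.length = w.length → v ≠ w →
      intK K (piece f K v) ∩ intK K (piece f K w) = ∅) ∧
  ∀ w : List (Fin k), closure (intK K (piece f K w)) ∩ K = piece f K w

open scoped NNReal
open Filter Topology MeasureTheory

lemma subset_iUnion_piece_ofFn {Y : Type*} {k : ℕ} {f : Fin k → Y → Y} {K : Set Y}
    (hK : K ⊆ ⋃ i, f i '' K) :
    ∀ n : ℕ, K ⊆ ⋃ v : Fin n → Fin k, piece f K (List.ofFn v)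
  | 0 => fun x hx => Set.mem_iUnion.2 ⟨Fin.elim0, by simpa [piece, wMap] using hx⟩
  | n + 1 => fun x hx => by
    obtain ⟨i, y, hy, rfl⟩ := Set.mem_iUnion.1 (hK hx)
    obtain ⟨v, z, hz, rfl⟩ := Set.mem_iUnion.1 (subset_iUnion_piece_ofFn hK n hy)
    exact Set.mem_iUnion.2 ⟨Fin.cons i v, z, hz, by simp [List.ofFn_succ, wMap]⟩

section Words

variable {k : ℕ} {f : Fin k → X → X} {r : Fin k → ℝ≥0} {K : Set X}

lemma lipschitzWith_wMap_ofFn (hf : ∀ i, LipschitzWith (r i) (f i)) :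
    ∀ {n : ℕ} (v : Fin n → Fin k),
      LipschitzWith (∏ l, r (v l)) (wMap f (List.ofFn v))
  | 0, v => by simpa [wMap] using LipschitzWith.id
  | n + 1, v => by
    rw [List.ofFn_succ, Fin.prod_univ_succ]
    exact (hf (v 0)).comp (lipschitzWith_wMap_ofFn hf fun l => v l.succ)

/-- If `K` is bounded and covered by its images under contractions with ratios `r i` satisfying
`∑ i, r i ^ s ≤ 1`, then `dimH K ≤ s`. -/
lemma dimH_le_of_subset_iUnion_image (hf : ∀ i, LipschitzWith (r i) (f i)) (hr : ∀ i, r i < 1)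
    (hKb : Bornology.IsBounded K) (hK : K ⊆ ⋃ i, f i '' K) {s : ℝ≥0}
    (hs : ∑ i, r i ^ (s : ℝ) ≤ 1) : dimH K ≤ s := by
  borelize X
  have hD : Metric.ediam K ≠ ⊤ := hKb.ediam_ne_top
  have hdiam {n : ℕ} (v : Fin n → Fin k) :
      Metric.ediam (piece f K (List.ofFn v)) ≤ ((∏ l, r (v l) : ℝ≥0) : ℝ≥0∞) * Metric.ediam K :=
    (lipschitzWith_wMap_ofFn hf v).ediam_image_le K
  obtain ⟨R, hR, hrR⟩ : ∃ R : ℝ≥0, R < 1 ∧ ∀ i, r i ≤ R :=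
    ⟨Finset.univ.sup r, (Finset.sup_lt_iff zero_lt_one).2 fun i _ => hr i,
      fun i => Finset.le_sup (Finset.mem_univ i)⟩
  apply dimH_le_of_hausdorffMeasure_ne_top
  have hlim : Tendsto (fun n : ℕ => (R : ℝ≥0∞) ^ n * Metric.ediam K) atTop (𝓝 0) := by
    simpa using ENNReal.Tendsto.mul_const
      (ENNReal.tendsto_pow_atTop_nhds_zero_of_lt_one (ENNReal.coe_lt_one_iff.2 hR)) (Or.inr hD)
  have hle := Measure.hausdorffMeasure_le_liminf_sum (s : ℝ) K _ hlim
    (fun n (v : Fin n → Fin k) => piece f K (List.ofFn v))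
    (Eventually.of_forall fun n v => (hdiam v).trans (by
      gcongr
      rw [← ENNReal.coe_pow, ENNReal.coe_le_coe]
      simpa using Finset.prod_le_pow_card Finset.univ (fun l => r (v l)) R fun l _ => hrR _))
    (Eventually.of_forall (subset_iUnion_piece_ofFn hK))
  refine ne_top_of_le_ne_top (ENNReal.rpow_ne_top_of_nonneg s.coe_nonneg hD)
    (hle.trans (liminf_le_of_le (by isBoundedDefault) fun b hb => ?_))
  obtain ⟨n, hn⟩ := hb.exists
  refine hn.trans ?_
  calc ∑ v : Fin n → Fin k, Metric.ediam (piece f K (List.ofFn v)) ^ (s : ℝ)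
      ≤ ∑ v : Fin n → Fin k, ((∏ l, r (v l) ^ (s : ℝ) : ℝ≥0) : ℝ≥0∞) *
          Metric.ediam K ^ (s : ℝ) := by
        gcongr with v
        rw [NNReal.finsetProd_rpow, ENNReal.coe_rpow_of_nonneg _ s.coe_nonneg,
          ← ENNReal.mul_rpow_of_nonneg _ _ s.coe_nonneg]
        gcongr
        exact hdiam v
    _ = (((∑ i, r i ^ (s : ℝ)) ^ n : ℝ≥0) : ℝ≥0∞) * Metric.ediam K ^ (s : ℝ) := by
        rw [← Finset.sum_mul, Fintype.sum_pow, ENNReal.ofNNReal_finsetSum]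
    _ ≤ Metric.ediam K ^ (s : ℝ) := by
        refine mul_le_of_le_one_left' ?_
        exact_mod_cast pow_le_one₀ zero_le hs

end Words

lemma exists_pos_lt_sum_rpow_le_one {ι : Type*} [Fintype ι] {r : ι → ℝ≥0} (hr : ∀ i, 0 < r i)
    {α : ℝ} (hα : 0 < α) (hlt : ∑ i, r i ^ α < 1) :
    ∃ s : ℝ≥0, (s : ℝ) < α ∧ ∑ i, r i ^ (s : ℝ) ≤ 1 := by
  have hcont : Tendsto (fun s : ℝ => ∑ i, r i ^ s) (𝓝[<] α) (𝓝 (∑ i, r i ^ α)) :=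
    tendsto_finsetSum _ fun i _ =>
      ((NNReal.continuousAt_rpow (Or.inl (hr i).ne')).comp
        (continuousAt_const.prodMk continuousAt_id)).tendsto.mono_left nhdsWithin_le_nhds
  obtain ⟨s, hs, hs0, hsα⟩ :=
    ((hcont.eventually_lt_const hlt).and (Ioo_mem_nhdsLT hα)).exists
  exact ⟨⟨s, hs0.le⟩, hsα, hs.le⟩

theorem stmt_3 {X : Type*} [MetricSpace X] [CompleteSpace X]
    {k : ℕ} (hk : 2 ≤ k) (f : Fin k → X → X) (c : Fin k → ℝ)
    (hc : ∀ i, c i ∈ Set.Ioo (0 : ℝ) 1)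
    (hf : ∀ i x y, dist (f i x) (f i y) = c i * dist x y)
    (K : Set X) (hKne : K.Nonempty) (hKcp : IsCompact K)
    (hK : K = ⋃ i, f i '' K)
    (α : ℝ) (hα : 0 < α) (hαsum : ∑ i, c i ^ α = 1)
    (hH : dimH K = ENNReal.ofReal α) :
    Irred f K := by
  lift c to Fin k → ℝ≥0 using fun i => (hc i).1.le
  have hsum : ∑ i, c i ^ α = 1 := by
    beta_reduce at hαsum
    exact_mod_cast hαsum
  have hlip (i : Fin k) : LipschitzWith (c i) (f i) :=
    LipschitzWith.of_dist_le_mul fun x y => (hf i x y).le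
  have hpos (i : Fin k) : 0 < c i := by exact_mod_cast (hc i).1
  have hlt (i : Fin k) : c i < 1 := by exact_mod_cast (hc i).2
  intro w hw
  obtain ⟨n, w, rfl⟩ : ∃ n, ∃ u : Fin n → Fin k, List.ofFn u = w := ⟨_, w.get, List.ofFn_get w⟩
  rcases n.eq_zero_or_pos with rfl | hn
  · obtain ⟨x, hx⟩ := hKne
    have hmem := hw ⟨x, hx, rfl⟩
    obtain ⟨v, ⟨hv, hne⟩, -⟩ := Set.mem_iUnion₂.1 hmem
    exact hne (by simpa using hv)
  let e := Fintype.equivFin {v : Fin n → Fin k // v ≠ w}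
  let r : {v : Fin n → Fin k // v ≠ w} → ℝ≥0 := fun v => ∏ l, c (v.1 l)
  have hrpos (v) : 0 < r v := Finset.prod_pos fun l _ => hpos _
  have hrlt (v) : r v < 1 := by
    calc r v < ∏ _l : Fin n, (1 : ℝ≥0) :=
          Finset.prod_lt_prod (fun l _ => hpos _) (fun l _ => (hlt _).le)
            ⟨⟨0, hn⟩, Finset.mem_univ _, hlt _⟩
      _ = 1 := Finset.prod_const_one
  have hsumlt : ∑ v, r v ^ α < 1 := by
    have htotal : ∑ v : Fin n → Fin k, (∏ l, c (v l)) ^ α = 1 := by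
      simp_rw [← NNReal.finsetProd_rpow]
      rw [← Fintype.sum_pow (fun i => c i ^ α), hsum, one_pow]
    rw [← htotal, Fintype.sum_eq_add_sum_subtype_ne _ w]
    exact lt_add_of_pos_left _ (NNReal.rpow_pos (Finset.prod_pos fun l _ => hpos _))
  obtain ⟨s, hsα, hs⟩ := exists_pos_lt_sum_rpow_le_one hrpos hα hsumlt
  have hcover : K ⊆ ⋃ i, wMap f (List.ofFn (e.symm i).1) '' K := by
    intro x hx
    obtain ⟨v, hv⟩ := Set.mem_iUnion.1 (subset_iUnion_piece_ofFn hK.subset n hx)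
    by_cases hvw : v = w
    · subst hvw
      have hmem := hw hv
      obtain ⟨u, ⟨hu, hne⟩, hxu⟩ := Set.mem_iUnion₂.1 hmem
      obtain rfl : u.length = n := by simpa using hu
      refine Set.mem_iUnion.2 ⟨e ⟨u.get, fun h => hne ?_⟩, ?_⟩
      · rw [← h, List.ofFn_get]
      · rw [e.symm_apply_apply, List.ofFn_get]
        exact hxu
    · exact Set.mem_iUnion.2 ⟨e ⟨v, hvw⟩, by rwa [e.symm_apply_apply]⟩
  have hdim : dimH K ≤ s :=
    dimH_le_of_subset_iUnion_image (r := fun i => r (e.symm i))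
      (fun i => lipschitzWith_wMap_ofFn hlip _) (fun i => hrlt _) hKcp.isBounded hcover
      ((e.symm.sum_comp fun v => r v ^ (s : ℝ)).trans_le hs)
  rw [hH, ← ENNReal.ofReal_coe_nnreal] at hdim
  exact hsα.not_ge ((ENNReal.ofReal_le_ofReal_iff s.coe_nonneg).1 hdim)

end IFSMoran
end

section
/- Let K be the attractor of an IFS of similitudes on a complete metric space with similarity dimension α, endowed with its natural fractal structure. If the natural fractal structure is irreducible, then H⁴^α(K) > 0. -/
open scoped ENNReal

namespace IFSMoran

variable {X : Type*} [MetricSpace X]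

/-- A Kraft-type inequality: if every word of length `n` has a prefix in `𝒜`, the total
weight of `𝒜` is at least one. -/
theorem one_le_sum_prod_of_prefix {k : ℕ} (p : Fin k → ℝ≥0∞) (hp : ∑ i, p i = 1) (n : ℕ)
    (𝒜 : Finset (List (Fin k)))
    (h : ∀ u : List (Fin k), u.length = n → ∃ w ∈ 𝒜, w <+: u) :
    1 ≤ ∑ w ∈ 𝒜, (w.map p).prod := by
  have key : ∀ 𝒞 : Finset (List (Fin k)), [] ∈ 𝒞 → 1 ≤ ∑ w ∈ 𝒞, (w.map p).prod := by
    intro 𝒞 h𝒞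
    simpa using Finset.single_le_sum (f := fun w : List (Fin k) => (w.map p).prod)
      (fun _ _ => zero_le) h𝒞
  induction n generalizing 𝒜 with
  | zero =>
    obtain ⟨w, hw, hwu⟩ := h [] rfl
    rw [List.prefix_nil] at hwu
    exact key 𝒜 (hwu ▸ hw)
  | succ n ih =>
    by_cases h0 : [] ∈ 𝒜
    · exact key 𝒜 h0
    let tails : Fin k → Finset (List (Fin k)) := fun i =>
      𝒜.preimage (List.cons i) (List.cons_injective.injOn)
    have htails : ∀ i, 1 ≤ ∑ w ∈ tails i, (w.map p).prod := by
      intro i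
      apply ih
      intro u hu
      obtain ⟨w, hw, hwu⟩ := h (i :: u) (by simp [hu])
      cases w with
      | nil => exact absurd hw h0
      | cons j v =>
        obtain ⟨rfl, hv⟩ := List.cons_prefix_cons.1 hwu
        exact ⟨v, by simpa [tails] using hw, hv⟩
    calc 1 = ∑ i, p i * 1 := by simp [hp]
      _ ≤ ∑ i, p i * ∑ w ∈ tails i, (w.map p).prod := by
        gcongr with i
        exact htails i
      _ = ∑ x ∈ Finset.univ.sigma tails, ((x.1 :: x.2).map p).prod := by
        simp [Finset.sum_sigma, Finset.mul_sum]
      _ = ∑ w ∈ (Finset.univ.sigma tails).image (fun x => x.1 :: x.2), (w.map p).prod := by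
        rw [Finset.sum_image]
        rintro ⟨i, v⟩ - ⟨j, w⟩ - hvw
        simp only [List.cons.injEq] at hvw
        obtain ⟨rfl, rfl⟩ := hvw
        rfl
      _ ≤ ∑ w ∈ 𝒜, (w.map p).prod := by
        apply Finset.sum_le_sum_of_subset
        intro w hw
        simp only [Finset.mem_image, Finset.mem_sigma, Finset.mem_univ, true_and] at hw
        obtain ⟨⟨i, v⟩, hv, rfl⟩ := hw
        simpa [tails] using hv

theorem piece_nil {Y : Type*} {k : ℕ} (f : Fin k → Y → Y) (K : Set Y) : piece f K [] = K := by
  simp [piece, wMap]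

theorem piece_cons {Y : Type*} {k : ℕ} (f : Fin k → Y → Y) (K : Set Y) (i : Fin k)
    (w : List (Fin k)) : piece f K (i :: w) = f i '' piece f K w := by
  simp [piece, wMap, Set.image_comp]

theorem piece_subset {Y : Type*} {k : ℕ} {f : Fin k → Y → Y} {K : Set Y} (hK : K = ⋃ i, f i '' K)
    (w : List (Fin k)) : piece f K w ⊆ K := by
  induction w with
  | nil => exact (piece_nil f K).subset
  | cons i w ih =>
    rw [piece_cons]
    exact (Set.image_mono ih).trans ((Set.subset_iUnion (fun i => f i '' K) i).trans hK.symm.subset)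

/-- Every piece is covered by the pieces of the words extending it by `m` letters. -/
theorem exists_mem_piece_append {Y : Type*} {k : ℕ} {f : Fin k → Y → Y} {K : Set Y}
    (hK : K = ⋃ i, f i '' K) (m : ℕ) (w : List (Fin k)) {x : Y} (hx : x ∈ piece f K w) :
    ∃ u : List (Fin k), u.length = m ∧ x ∈ piece f K (w ++ u) := by
  induction w generalizing x with
  | cons i w ih =>
    rw [piece_cons] at hx
    obtain ⟨y, hy, rfl⟩ := hx
    obtain ⟨u, hu, hyu⟩ := ih hy
    exact ⟨u, hu, by rw [List.cons_append, piece_cons]; exact Set.mem_image_of_mem _ hyu⟩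
  | nil =>
    rw [piece_nil] at hx
    simp only [List.nil_append]
    induction m generalizing x with
    | zero => exact ⟨[], rfl, by rwa [piece_nil]⟩
    | succ m ih =>
      rw [hK, Set.mem_iUnion] at hx
      obtain ⟨i, y, hy, rfl⟩ := hx
      obtain ⟨u, hu, hyu⟩ := ih hy
      exact ⟨i :: u, by simp [hu], by rw [piece_cons]; exact Set.mem_image_of_mem _ hyu⟩

/-- For an irreducible structure, a finite family of words whose pieces cover `K` contains a
prefix of every sufficiently long word. -/
theorem Irred.exists_prefix {Y : Type*} {k : ℕ} {f : Fin k → Y → Y} {K : Set Y} (hirr : Irred f K)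
    (hK : K = ⋃ i, f i '' K) {𝒜 : Finset (List (Fin k))} (hcov : K ⊆ ⋃ w ∈ 𝒜, piece f K w)
    (u : List (Fin k)) (hu : ∀ w ∈ 𝒜, w.length ≤ u.length) : ∃ w ∈ 𝒜, w <+: u := by
  by_contra! hno
  refine hirr u fun x hx => ?_
  obtain ⟨w, hw, hxw⟩ := Set.mem_iUnion₂.1 (hcov (piece_subset hK u hx))
  obtain ⟨v, hv, hxv⟩ := exists_mem_piece_append hK (u.length - w.length) w hxw
  refine Set.mem_iUnion₂.2 ⟨w ++ v, ⟨?_, ?_⟩, hxv⟩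
  · have := hu w hw
    simp only [List.length_append]
    omega
  · rintro rfl
    exact hno w hw (List.prefix_append w v)

theorem ediam_image_of_dist_eq_mul {g : X → X} {r : ℝ} (hr : 0 < r)
    (hg : ∀ x y, dist (g x) (g y) = r * dist x y) (S : Set X) :
    Metric.ediam (g '' S) = ENNReal.ofReal r * Metric.ediam S := by
  have h : ∀ x y, edist (g x) (g y) = ENNReal.ofReal r * edist x y := fun x y => by
    rw [edist_dist, edist_dist, hg, ENNReal.ofReal_mul hr.le]
  simp only [Metric.ediam, iSup_image, h, ENNReal.mul_iSup]

theorem ediam_piece_rpow {k : ℕ} {f : Fin k → X → X} {c : Fin k → ℝ} (hc : ∀ i, 0 < c i)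
    (hf : ∀ i x y, dist (f i x) (f i y) = c i * dist x y) (K : Set X) {s : ℝ} (hs : 0 ≤ s)
    (w : List (Fin k)) :
    Metric.ediam (piece f K w) ^ s =
      (w.map fun i => ENNReal.ofReal (c i ^ s)).prod * Metric.ediam K ^ s := by
  induction w with
  | nil => simp [piece_nil]
  | cons i w ih =>
    rw [piece_cons, ediam_image_of_dist_eq_mul (hc i) (hf i), ENNReal.mul_rpow_of_nonneg _ _ hs,
      ih, ENNReal.ofReal_rpow_of_pos (hc i), List.map_cons, List.prod_cons, mul_assoc]

/-- An irreducible structure with at least two maps lives on a nontrivial set. -/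
theorem Irred.nontrivial {Y : Type*} {k : ℕ} (hk : 2 ≤ k) {f : Fin k → Y → Y} {K : Set Y}
    (hirr : Irred f K) (hKne : K.Nonempty) (hK : K = ⋃ i, f i '' K) : K.Nontrivial := by
  by_contra hsub
  rw [Set.not_nontrivial_iff] at hsub
  let i : Fin k := ⟨0, by omega⟩
  let j : Fin k := ⟨1, by omega⟩
  refine hirr [i] fun x hx => Set.mem_iUnion₂.2 ⟨[j], ⟨rfl, by simp [i, j]⟩, ?_⟩
  obtain ⟨y, hy⟩ : (piece f K [j]).Nonempty := hKne.image _
  rwa [hsub (piece_subset hK _ hx) (piece_subset hK _ hy)]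

theorem stmt_4 {X : Type*} [MetricSpace X] [CompleteSpace X]
    {k : ℕ} (hk : 2 ≤ k) (f : Fin k → X → X) (c : Fin k → ℝ)
    (hc : ∀ i, c i ∈ Set.Ioo (0 : ℝ) 1)
    (hf : ∀ i x y, dist (f i x) (f i y) = c i * dist x y)
    (K : Set X) (hKne : K.Nonempty) (hKcp : IsCompact K)
    (hK : K = ⋃ i, f i '' K)
    (α : ℝ) (hα : 0 < α) (hαsum : ∑ i, c i ^ α = 1)
    (hirr : Irred f K) :
    0 < H4 f K α := by
  have hsum : ∑ i, ENNReal.ofReal (c i ^ α) = 1 := by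
    rw [← ENNReal.ofReal_sum_of_nonneg fun i _ => Real.rpow_nonneg (hc i).1.le α, hαsum,
      ENNReal.ofReal_one]
  have hpos : 0 < Metric.ediam K ^ α := by
    have := Metric.ediam_pos_iff.2 (hirr.nontrivial hk hKne hK)
    simpa [pos_iff_ne_zero, ENNReal.rpow_eq_zero_iff, hα, hα.not_gt] using this.ne'
  refine hpos.trans_le (le_iSup_of_le 0 ?_)
  refine le_iInf fun 𝒜 => le_iInf fun _ => le_iInf fun hcov => ?_
  have hone := one_le_sum_prod_of_prefix _ hsum (𝒜.sup List.length) 𝒜 fun u hu =>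
    hirr.exists_prefix hK hcov u fun w hw => hu ▸ Finset.le_sup (f := List.length) hw
  calc Metric.ediam K ^ α ≤ (∑ w ∈ 𝒜, (w.map fun i => ENNReal.ofReal (c i ^ α)).prod)
        * Metric.ediam K ^ α := le_mul_of_one_le_left zero_le hone
    _ = ∑ w ∈ 𝒜, Metric.ediam (piece f K w) ^ α := by
      rw [Finset.sum_mul]
      exact Finset.sum_congr rfl fun w _ =>
        (ediam_piece_rpow (fun i => (hc i).1) hf K hα.le w).symm

end IFSMoran
end

section
/- Let K be the attractor of an IFS of similitudes on a complete metric space, endowed with its natural fractal structure. Then F satisfies the level separation property (LSP) if and only if the natural fractal structure is irreducible. -/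
open scoped ENNReal

namespace IFSMoran

variable {X : Type*} [MetricSpace X]

theorem wMap_append {Y : Type*} {k : ℕ} (f : Fin k → Y → Y) (v w : List (Fin k)) (x : Y) :
    wMap f (v ++ w) x = wMap f v (wMap f w x) := by
  induction v with
  | nil => rfl
  | cons i v ih => simp [wMap, ih]

theorem continuous_wMap {k : ℕ} {f : Fin k → X → X} (hf : ∀ i, Continuous (f i))
    (w : List (Fin k)) : Continuous (wMap f w) := by
  induction w with
  | nil => exact continuous_id
  | cons i w ih => exact (hf i).comp ih

theorem dist_wMap_le {k : ℕ} {f : Fin k → X → X} {q : ℝ} (hq : 0 ≤ q)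
    (hf : ∀ i x y, dist (f i x) (f i y) ≤ q * dist x y) (w : List (Fin k)) (x y : X) :
    dist (wMap f w x) (wMap f w y) ≤ q ^ w.length * dist x y := by
  induction w with
  | nil => simp [wMap]
  | cons i w ih =>
    calc dist (f i (wMap f w x)) (f i (wMap f w y))
        ≤ q * dist (wMap f w x) (wMap f w y) := hf i _ _
      _ ≤ q * (q ^ w.length * dist x y) := by gcongr
      _ = q ^ (i :: w).length * dist x y := by rw [List.length_cons]; ring

theorem exists_mem_piece {Y : Type*} {k : ℕ} {f : Fin k → Y → Y} {K : Set Y}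
    (hK : K = ⋃ i, f i '' K) (n : ℕ) {x : Y} (hx : x ∈ K) : ∃ w : List (Fin k), w.length = n ∧ x ∈ piece f K w := by
  induction n generalizing x with
  | zero => exact ⟨[], rfl, x, hx, rfl⟩
  | succ n ih =>
    rw [hK] at hx
    obtain ⟨i, y, hy, rfl⟩ := Set.mem_iUnion.1 hx
    obtain ⟨w, hw, z, hz, rfl⟩ := ih hy
    exact ⟨i :: w, by simp [hw], z, hz, rfl⟩

theorem intK_subset (K A : Set X) : intK K A ⊆ A := by
  rintro x ⟨hx, hxA⟩
  by_contra h
  exact hxA (subset_closure ⟨hx, h⟩)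

theorem mem_intK {K A V : Set X} {x : X} (hV : IsOpen V) (hxV : x ∈ V) (hxK : x ∈ K)
    (h : V ∩ K ⊆ A) : x ∈ intK K A := by
  refine ⟨hxK, fun hx => ?_⟩
  obtain ⟨y, hyV, hyK, hyA⟩ := mem_closure_iff.1 hx V hV hxV
  exact hyA (h ⟨hyV, hyK⟩)

/-- A nonempty relatively open set covered by finitely many closed sets meets the relative interior
of one of them. -/
theorem exists_inter_intK_nonempty {ι : Type*} {K : Set X} {A : ι → Set X} {S : Set ι}
    (hS : S.Finite) (hA : ∀ i, IsClosed (A i)) {V : Set X} (hV : IsOpen V)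
    (hne : (V ∩ K).Nonempty) (hcov : V ∩ K ⊆ ⋃ i ∈ S, A i) :
    ∃ i ∈ S, (V ∩ intK K (A i)).Nonempty := by
  induction S, hS using Set.Finite.induction_on generalizing V with
  | empty =>
    obtain ⟨x, hx⟩ := hne
    simpa using hcov hx
  | @insert a S _ _ ih =>
    by_cases h : V ∩ K ⊆ A a
    · obtain ⟨x, hxV, hxK⟩ := hne
      exact ⟨a, Set.mem_insert _ _, x, hxV, mem_intK hV hxV hxK h⟩
    · obtain ⟨y, ⟨hyV, hyK⟩, hyA⟩ := Set.not_subset.1 h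
      obtain ⟨i, hi, z, hzV, hz⟩ := ih (hV.sdiff (hA a)) ⟨y, ⟨hyV, hyA⟩, hyK⟩ (by
        rintro z ⟨⟨hzV, hzA⟩, hzK⟩
        have := hcov ⟨hzV, hzK⟩
        rw [Set.biUnion_insert] at this
        exact this.resolve_left hzA)
      exact ⟨i, Set.mem_insert_of_mem _ hi, z, hzV.1, hz⟩

theorem finite_words_ne {k : ℕ} (w : List (Fin k)) :
    {v : List (Fin k) | v.length = w.length ∧ v ≠ w}.Finite :=
  (List.finite_length_eq (Fin k) w.length).subset fun _ hv => hv.1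

theorem LSP.irred {k : ℕ} {f : Fin k → X → X} {K : Set X}
    (hcl : ∀ w, IsClosed (piece f K w)) (h : LSP f K) : Irred f K := by
  intro w hw
  obtain ⟨x, hxK, hx⟩ := h.2 w
  have hsub : (closure (K \ piece f K w))ᶜ ∩ K ⊆ piece f K w := fun y hy =>
    intK_subset K _ ⟨hy.2, hy.1⟩
  obtain ⟨v, hv, y, hyV, hy⟩ := exists_inter_intK_nonempty (finite_words_ne w) hcl
    isClosed_closure.isOpen_compl ⟨x, hx, hxK⟩ (hsub.trans hw)
  exact (h.1 v w hv.1 hv.2).subset ⟨hy, hy.1, hyV⟩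

theorem Irred.intK_nonempty {k : ℕ} {f : Fin k → X → X} {K : Set X} (hK : K = ⋃ i, f i '' K)
    (hcl : ∀ w, IsClosed (piece f K w)) (h : Irred f K) (w : List (Fin k)) :
    (intK K (piece f K w)).Nonempty := by
  obtain ⟨x, hxw, hx⟩ := Set.not_subset.1 (h w)
  refine ⟨x, mem_intK ((finite_words_ne w).isClosed_biUnion fun v _ => hcl v).isOpen_compl hx
    (piece_subset hK w hxw) ?_⟩
  rintro y ⟨hy, hyK⟩
  obtain ⟨v, hv, hyv⟩ := exists_mem_piece hK w.length hyK
  by_cases hvw : v = w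
  · exact hvw ▸ hyv
  · exact absurd (Set.mem_iUnion₂.2 ⟨v, ⟨hv, hvw⟩, hyv⟩) hy

/-- Every point of a piece lies in arbitrarily small subpieces of it. -/
theorem exists_subpiece_subset_ball {k : ℕ} {f : Fin k → X → X} {K : Set X} {q : ℝ}
    (hq : 0 ≤ q) (hq1 : q < 1) (hf : ∀ i x y, dist (f i x) (f i y) ≤ q * dist x y)
    (hKb : Bornology.IsBounded K) (hK : K = ⋃ i, f i '' K) {v : List (Fin k)} {x : X}
    (hx : x ∈ piece f K v) {ε : ℝ} (hε : 0 < ε) :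
    ∃ u, piece f K (v ++ u) ⊆ Metric.ball x ε := by
  obtain ⟨y, hy, rfl⟩ := hx
  have hlim := (tendsto_pow_atTop_nhds_zero_of_lt_one hq hq1).mul_const (Metric.diam K)
  rw [zero_mul] at hlim
  obtain ⟨n, hn⟩ := (hlim.eventually (gt_mem_nhds hε)).exists
  obtain ⟨u, rfl, z, hz, rfl⟩ := exists_mem_piece hK n hy
  refine ⟨u, ?_⟩
  rintro _ ⟨t, ht, rfl⟩
  rw [← wMap_append]
  calc dist (wMap f (v ++ u) t) (wMap f (v ++ u) z)
      ≤ q ^ (v ++ u).length * dist t z := dist_wMap_le hq hf _ _ _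
    _ ≤ q ^ u.length * Metric.diam K := by
      gcongr ?_ * ?_
      · exact pow_le_pow_of_le_one hq hq1.le (by simp)
      · exact Metric.dist_le_diam_of_mem hKb ht hz
    _ < ε := hn

theorem Irred.intK_inter_eq_empty {k : ℕ} {f : Fin k → X → X} {K : Set X} {q : ℝ}
    (hq : 0 ≤ q) (hq1 : q < 1) (hf : ∀ i x y, dist (f i x) (f i y) ≤ q * dist x y)
    (hKb : Bornology.IsBounded K) (hK : K = ⋃ i, f i '' K) (h : Irred f K)
    {v w : List (Fin k)} (hlen : v.length = w.length) (hne : v ≠ w) :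
    intK K (piece f K v) ∩ intK K (piece f K w) = ∅ := by
  rw [Set.eq_empty_iff_forall_notMem]
  rintro x ⟨hxv, _, hxw⟩
  obtain ⟨ε, hε, hball⟩ := Metric.isOpen_iff.1 isClosed_closure.isOpen_compl x hxw
  obtain ⟨u, hu⟩ := exists_subpiece_subset_ball hq hq1 hf hKb hK (intK_subset K _ hxv) hε
  refine h (v ++ u) fun y hy => ?_
  obtain ⟨z, hz, rfl⟩ := intK_subset K _ ⟨piece_subset hK _ hy, hball (hu hy)⟩
  obtain ⟨t, ht, s, hs, rfl⟩ := exists_mem_piece hK u.length hz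
  refine Set.mem_biUnion (x := w ++ t) ⟨by simp [ht, hlen], fun heq => hne ?_⟩
    ⟨s, hs, wMap_append f w t s⟩
  exact (List.append_inj heq.symm hlen).1

theorem stmt_9 {X : Type*} [MetricSpace X] [CompleteSpace X]
    {k : ℕ} (hk : 2 ≤ k) (f : Fin k → X → X) (c : Fin k → ℝ)
    (hc : ∀ i, c i ∈ Set.Ioo (0 : ℝ) 1)
    (hf : ∀ i x y, dist (f i x) (f i y) = c i * dist x y)
    (K : Set X) (hKne : K.Nonempty) (hKcp : IsCompact K)
    (hK : K = ⋃ i, f i '' K) :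
    LSP f K ↔ Irred f K := by
  have hcont : ∀ i, Continuous (f i) := fun i =>
    (LipschitzWith.of_dist_le_mul (K := ⟨c i, (hc i).1.le⟩) fun x y => (hf i x y).le).continuous
  have hcl : ∀ w, IsClosed (piece f K w) := fun w =>
    (hKcp.image (continuous_wMap hcont w)).isClosed
  have : Nonempty (Fin k) := ⟨⟨0, by omega⟩⟩
  obtain ⟨m, hm⟩ := Finite.exists_max c
  have hfm : ∀ i x y, dist (f i x) (f i y) ≤ c m * dist x y := fun i x y =>
    (hf i x y).trans_le (mul_le_mul_of_nonneg_right (hm i) dist_nonneg)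
  exact ⟨LSP.irred hcl, fun h =>
    ⟨fun _ _ => h.intK_inter_eq_empty (hc m).1.le (hc m).2 hfm hKcp.isBounded hK,
      h.intK_nonempty hK hcl⟩⟩

end IFSMoran
end
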